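/- Matrix coefficients of pairwise non-equivalent irreducible finite-dimensional representations of a group G are linearly independent as functions on G. -/

import Mathlib

def RepIsIrreducible {G : Type*} [Group G] {V : Type*} [AddCommGroup V] [Module ℂ V]
    (ρ : Representation ℂ G V) : Prop :=
  Nontrivial V ∧ ∀ p : Submodule ℂ V, (∀ g : G, ∀ v ∈ p, ρ g v ∈ p) → p = ⊥ ∨ p = ⊤

theorem density_aux {A : Type*} [Ring A] [Algebra ℂ A] {k : ℕ} (M : Fin k → Type*)
    [∀ i, AddCommGroup (M i)] [∀ i, Module ℂ (M i)] [∀ i, Module A (M i)]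
    [∀ i, IsScalarTower ℂ A (M i)] [∀ i, FiniteDimensional ℂ (M i)]
    [∀ i, IsSimpleModule A (M i)]
    (hne : ∀ i j, i ≠ j → IsEmpty (M i ≃ₗ[A] M j))
    (E : ∀ i, M i →ₗ[ℂ] M i) : ∃ a : A, ∀ i m, E i m = a • m := by
  classical
  have key : ∀ (φ : Module.End A (∀ i, M i)) (i : Fin k), ∃ c : ℂ, ∀ x, φ x i = c • x i := by
    intro φ i
    obtain ⟨c, hc⟩ := (IsSimpleModule.algebraMap_end_bijective_of_isAlgClosed
      (A := A) (V := M i) ℂ).2 ((LinearMap.proj i) ∘ₗ φ ∘ₗ (LinearMap.single A M i))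
    refine ⟨c, fun x => ?_⟩
    have hx : x = ∑ j, Pi.single j (x j) := (Finset.univ_sum_single x).symm
    conv_lhs => rw [hx]
    rw [map_sum, Finset.sum_apply, Finset.sum_eq_single i]
    · exact (congrArg (fun f : Module.End A (M i) => f (x i)) hc).symm
    · intro j _ hj
      rcases LinearMap.bijective_or_eq_zero
        ((LinearMap.proj i) ∘ₗ φ ∘ₗ (LinearMap.single A M j)) with h | h
      · exact ((hne j i hj).false (LinearEquiv.ofBijective _ h)).elim
      · exact congrArg (fun f : M j →ₗ[A] M i => f (x j)) h
    · simp
  let f : Module.End (Module.End A (∀ i, M i)) (∀ i, M i) :=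
    { toFun := fun x i => E i (x i)
      map_add' := fun x y => by ext i; simp
      map_smul' := fun φ x => by
        ext i
        obtain ⟨c, hc⟩ := key φ i
        simp [hc] }
  let b := Module.finBasis ℂ (∀ i, M i)
  have : IsSemisimpleModule A (∀ i, M i) :=
    IsSemisimpleModule.congr (DFinsupp.linearEquivFunOnFintype (R := A) (M := M)).symm
  obtain ⟨a, ha⟩ := jacobson_density f (Finset.univ.image b)
  refine ⟨a, fun i m => ?_⟩
  have hlin : LinearMap.pi (fun i => E i ∘ₗ LinearMap.proj i)
      = Algebra.lsmul ℂ ℂ (∀ i, M i) a := by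
    refine b.ext fun n => ?_
    exact ha (b n) (Finset.mem_image_of_mem _ (Finset.mem_univ n))
  have := congrFun (congrArg (fun g => g (Pi.single i m)) hlin) i
  simpa using this

theorem trace_aux {V : Type*} [AddCommGroup V] [Module ℂ V] [FiniteDimensional ℂ V]
    (D : V →ₗ[ℂ] V) (h : ∀ E : V →ₗ[ℂ] V, LinearMap.trace ℂ V (D ∘ₗ E) = 0) : D = 0 := by
  classical
  let b := Module.finBasis ℂ V
  apply (LinearMap.toMatrix b b).injective
  rw [map_zero]
  refine Matrix.ext_iff_trace_mul_right.2 fun X => ?_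
  have := h (Matrix.toLin b b X)
  rw [LinearMap.trace_eq_matrix_trace ℂ b, LinearMap.toMatrix_comp b b b,
    LinearMap.toMatrix_toLin] at this
  simpa using this

/-- Matrix coefficients of pairwise non-equivalent irreducible finite-dimensional
representations are linearly independent: if `Σᵢ Tr(Dᵢ·ρᵢ(g)) = 0` for all `g`,
then every `Dᵢ = 0`. -/
theorem stmt18 {G : Type*} [Group G] {k : ℕ} (V : Fin k → Type*)
    [∀ i, AddCommGroup (V i)] [∀ i, Module ℂ (V i)] [∀ i, FiniteDimensional ℂ (V i)]
    (ρ : ∀ i, Representation ℂ G (V i))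
    (hirr : ∀ i, RepIsIrreducible (ρ i))
    (hne : ∀ i j, i ≠ j →
      ¬ ∃ T : V i ≃ₗ[ℂ] V j, ∀ (g : G) (v : V i), T (ρ i g v) = ρ j g (T v))
    (D : ∀ i, V i →ₗ[ℂ] V i)
    (h : ∀ g : G, ∑ i, LinearMap.trace ℂ (V i) ((D i) ∘ₗ (ρ i g)) = 0) :
    ∀ i, D i = 0 := by
  classical
  have hs : ∀ i, IsSimpleModule (MonoidAlgebra ℂ G) (ρ i).asModule := by
    intro i
    rw [← Representation.irreducible_iff_isSimpleModule_asModule]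
    obtain ⟨hn, hp⟩ := hirr i
    have hnt : Nontrivial (Subrepresentation (ρ i)) := by
      refine ⟨⊥, ⊤, fun hbt => ?_⟩
      exact bot_ne_top (α := Submodule ℂ (V i))
        (congrArg Subrepresentation.toSubmodule hbt)
    refine { exists_pair_ne := hnt.exists_pair_ne, eq_bot_or_eq_top := fun p => ?_ }
    rcases hp p.toSubmodule (fun g v hv => p.apply_mem_toSubmodule g hv) with h | h
    · exact Or.inl (Subrepresentation.toSubmodule_injective h)
    · exact Or.inr (Subrepresentation.toSubmodule_injective h)
  have hE : ∀ i j, i ≠ j →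
      IsEmpty ((ρ i).asModule ≃ₗ[MonoidAlgebra ℂ G] (ρ j).asModule) := by
    intro i j hij
    refine ⟨fun T => hne i j hij ⟨(ρ i).asModuleEquiv.symm ≪≫ₗ
      (T.restrictScalars ℂ) ≪≫ₗ (ρ j).asModuleEquiv, fun g v => ?_⟩⟩
    simp only [LinearEquiv.trans_apply, Representation.asModuleEquiv_symm_map_rho,
      LinearEquiv.restrictScalars_apply, map_smul, Representation.asModuleEquiv_map_smul,
      Representation.asAlgebraHom_of]
  have hall : ∀ a : MonoidAlgebra ℂ G,
      ∑ i, LinearMap.trace ℂ (V i) ((D i) ∘ₗ ((ρ i).asAlgebraHom a)) = 0 := by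
    intro a
    induction a using MonoidAlgebra.induction_on with
    | of g => simpa [Representation.asAlgebraHom_of] using h g
    | add x y hx hy =>
      simp only [map_add, LinearMap.comp_add, Finset.sum_add_distrib, hx, hy, add_zero]
    | smul r x hx =>
      simp only [map_smul, LinearMap.comp_smul, ← Finset.smul_sum, hx, smul_zero]
  intro i
  refine trace_aux _ fun E => ?_
  obtain ⟨a, ha⟩ := density_aux (A := MonoidAlgebra ℂ G) (fun i => (ρ i).asModule) hE
    (fun j => (ρ j).asModuleEquiv.symm.toLinearMap ∘ₗ
      (Pi.single (M := fun j => V j →ₗ[ℂ] V j) i E j) ∘ₗ (ρ j).asModuleEquiv.toLinearMap)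
  have ha' : ∀ j, (ρ j).asAlgebraHom a = Pi.single (M := fun j => V j →ₗ[ℂ] V j) i E j := by
    intro j
    ext v
    exact (ha j ((ρ j).asModuleEquiv.symm v)).symm
  have := hall a
  simp only [ha'] at this
  rw [Finset.sum_eq_single i] at this
  · simpa using this
  · intro j _ hj
    simp [Pi.single_eq_of_ne hj]
  · simp
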